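/- For every integer m ≥ 6, Σ_{t ∈ I_m} o(t)²·2^{m − o(t)} = m!·((m+1)²/9 + 2(m+1)/45). Equivalently, the variance of the number of cherries of a ranked tree of size n > 6 generated by the coalescent process is 2n/45. -/

import Mathlib

/-- A 0-1-2-increasing tree of size `m`: vertices are `Fin m` (index `i`
represents label `i+1`, so index `0` is the root labelled `1`), encoded by a
parent function `f` with `f i < i` for every non-root vertex `i`
(and `f 0 = 0` by convention), such that every vertex has at most 2 children. -/
abbrev IncTree (m : ℕ) : Type :=
  {f : Fin m → Fin m //
    (∀ i : Fin m, i.val = 0 → f i = i) ∧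
    (∀ i : Fin m, i.val ≠ 0 → (f i).val < i.val) ∧
    (∀ j : Fin m, (Finset.univ.filter (fun i : Fin m => i.val ≠ 0 ∧ f i = j)).card ≤ 2)}

/-- The number of children of the vertex `j` in the tree `t`. -/
def numChildren {m : ℕ} (t : IncTree m) (j : Fin m) : ℕ :=
  (Finset.univ.filter (fun i : Fin m => i.val ≠ 0 ∧ t.val i = j)).card

/-- `o t`: the number of leaves (outdegree-0 vertices) of `t`. -/
def numLeaves {m : ℕ} (t : IncTree m) : ℕ :=
  (Finset.univ.filter (fun j : Fin m => numChildren t j = 0)).card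

theorem ct_le {m : ℕ} (t : IncTree m) (j : Fin m) : numChildren t j ≤ 2 := t.2.2.2 j

theorem nl_le {m : ℕ} (t : IncTree m) : numLeaves t ≤ m := by
  unfold numLeaves
  exact (Finset.card_le_univ _).trans (by simp)

theorem snoc_card {m : ℕ} (hm : 1 ≤ m) (f : Fin m → Fin m) (j k : Fin m) :
    (Finset.univ.filter (fun i : Fin (m+1) => i.val ≠ 0 ∧
      (Fin.snoc (α := fun _ => Fin (m+1)) (fun i => (f i).castSucc) j.castSucc : Fin (m+1) → Fin (m+1)) i
        = k.castSucc)).card =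
    (Finset.univ.filter (fun i : Fin m => i.val ≠ 0 ∧ f i = k)).card + if j = k then 1 else 0 := by
  have : m ≠ 0 := by omega
  simp only [Finset.card_filter, Fin.sum_univ_castSucc, Fin.snoc_castSucc, Fin.snoc_last,
    Fin.castSucc_inj, Fin.val_castSucc, Fin.val_last]
  simp [this]

theorem snoc_card_last {m : ℕ} (f : Fin m → Fin m) (j : Fin m) :
    (Finset.univ.filter (fun i : Fin (m+1) => i.val ≠ 0 ∧
      (Fin.snoc (α := fun _ => Fin (m+1)) (fun i => (f i).castSucc) j.castSucc : Fin (m+1) → Fin (m+1)) i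
        = Fin.last m)).card = 0 := by
  simp only [Finset.card_filter, Fin.sum_univ_castSucc, Fin.snoc_castSucc, Fin.snoc_last]
  simp [Fin.castSucc_ne_last]

def extTree {m : ℕ} (hm : 1 ≤ m) (p : Σ t : IncTree m, {j : Fin m // numChildren t j ≤ 1}) :
    IncTree (m+1) :=
  ⟨Fin.snoc (α := fun _ => Fin (m+1)) (fun i => (p.1.1 i).castSucc) p.2.1.castSucc, by
    obtain ⟨⟨f, h0, h1, h2⟩, j, hj⟩ := p
    refine ⟨?_, ?_, ?_⟩
    · intro i
      refine Fin.lastCases ?_ (fun i => ?_) i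
      · intro h; simp at h; omega
      · intro h
        simp only [Fin.snoc_castSucc]
        rw [h0 i (by simpa using h)]
    · intro i
      refine Fin.lastCases ?_ (fun i => ?_) i
      · intro h; simp
      · intro h
        simp only [Fin.snoc_castSucc]
        exact h1 i (by simpa using h)
    · intro k
      refine Fin.lastCases ?_ (fun k => ?_) k
      · rw [snoc_card_last]; omega
      · rw [snoc_card hm]
        have := h2 k
        unfold numChildren at hj
        simp only at hj
        split_ifs with h
        · have h' : j = k := h
          subst h'
          exact Nat.succ_le_succ hj
        · exact this⟩

theorem ext_nl {m : ℕ} (hm : 1 ≤ m) (t : IncTree m) (j : {j : Fin m // numChildren t j ≤ 1}) :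
    numLeaves (extTree hm ⟨t, j⟩) = if numChildren t j.1 = 0 then numLeaves t else numLeaves t + 1 := by
  have hc : ∀ k : Fin m, numChildren (extTree hm ⟨t, j⟩) k.castSucc
      = numChildren t k + if j.1 = k then 1 else 0 := fun k => snoc_card hm t.1 j.1 k
  have hl : numChildren (extTree hm ⟨t, j⟩) (Fin.last m) = 0 := snoc_card_last t.1 j.1
  unfold numLeaves
  simp only [Finset.card_filter, Fin.sum_univ_castSucc, hc, hl]
  have key : ∑ k : Fin m, (if numChildren t k = 0 then 1 else 0) =
      ∑ k : Fin m, (if (numChildren t k + if j.1 = k then 1 else 0) = 0 then 1 else 0)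
      + ∑ k : Fin m, (if j.1 = k then (if numChildren t j.1 = 0 then 1 else 0) else 0) := by
    rw [← Finset.sum_add_distrib]
    refine Finset.sum_congr rfl fun k _ => ?_
    by_cases h : j.1 = k
    · simp [h]
    · simp [h]
  rw [key, Finset.sum_ite_eq]
  split_ifs <;> simp_all

theorem ext_bij {m : ℕ} (hm : 1 ≤ m) : Function.Bijective (extTree hm) := by
  constructor
  · rintro ⟨⟨f, hf⟩, j, hj⟩ ⟨⟨g, hg⟩, k, hk⟩ h
    have h' := congrArg Subtype.val h
    simp only [extTree] at h'
    have e1 : f = g := by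
      funext i
      have := congrFun h' i.castSucc
      simpa using this
    have e2 : j = k := by
      have := congrFun h' (Fin.last m)
      simpa using this
    subst e1; subst e2; rfl
  · rintro ⟨g, h0, h1, h2⟩
    have hlt : ∀ i : Fin m, (g i.castSucc).val < m := by
      intro i
      by_cases h : i.val = 0
      · rw [h0 _ (by simpa using h)]; simp
      · have := h1 i.castSucc (by simpa using h)
        have := i.2
        simp at *; omega
    have hlt' : (g (Fin.last m)).val < m := by
      have := h1 (Fin.last m) (by simp; omega)
      simpa using this
    let f : Fin m → Fin m := fun i => ⟨g i.castSucc, hlt i⟩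
    let j : Fin m := ⟨g (Fin.last m), hlt'⟩
    have hg : g = Fin.snoc (α := fun _ => Fin (m+1)) (fun i => (f i).castSucc) j.castSucc := by
      funext i
      refine Fin.lastCases ?_ (fun i => ?_) i
      · simp [j]
      · simp [f]
    have hk : ∀ k : Fin m, (Finset.univ.filter (fun i : Fin m => i.val ≠ 0 ∧ f i = k)).card
        + (if j = k then 1 else 0) ≤ 2 := by
      intro k
      rw [← snoc_card hm, ← hg]
      exact h2 _
    refine ⟨⟨⟨f, ?_, ?_, ?_⟩, j, ?_⟩, ?_⟩
    · intro i hi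
      apply Fin.ext
      have := h0 i.castSucc (by simpa using hi)
      simp [f, this]
    · intro i hi
      exact h1 i.castSucc (by simpa using hi)
    · intro k
      have := hk k
      omega
    · have := hk j
      simp at this
      unfold numChildren
      simp only
      exact this
    · apply Subtype.ext
      exact hg.symm

theorem sum_nc {m : ℕ} (hm : 1 ≤ m) (t : IncTree m) : ∑ j, numChildren t j + 1 = m := by
  obtain ⟨m, rfl⟩ : ∃ k, m = k + 1 := ⟨m - 1, by omega⟩
  unfold numChildren
  simp only [Finset.card_filter]
  rw [Finset.sum_comm]
  have : ∀ i : Fin (m+1), ∑ j, (if i.val ≠ 0 ∧ t.1 i = j then 1 else 0)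
      = if i.val ≠ 0 then 1 else 0 := by
    intro i
    by_cases h : i.val = 0 <;> simp [h]
  rw [Finset.sum_congr rfl (fun i _ => this i), Fin.sum_univ_succ]
  simp

theorem count_eq {m : ℕ} (hm : 1 ≤ m) (t : IncTree m) :
    2 * numLeaves t + (Finset.univ.filter (fun j => numChildren t j = 1)).card = m + 1 := by
  have h : 2 * numLeaves t + (Finset.univ.filter (fun j => numChildren t j = 1)).card
      + ∑ j, numChildren t j = 2 * m := by
    unfold numLeaves
    simp only [Finset.card_filter]
    rw [Finset.mul_sum, ← Finset.sum_add_distrib, ← Finset.sum_add_distrib]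
    have : ∀ j : Fin m, (2 * (if numChildren t j = 0 then 1 else 0) +
        if numChildren t j = 1 then 1 else 0) + numChildren t j = 2 := by
      intro j
      have := ct_le t j
      split_ifs <;> omega
    rw [Finset.sum_congr rfl (fun i _ => this i)]
    simp [mul_comm]
  have := sum_nc hm t
  omega

theorem rec_sum {m : ℕ} (hm : 1 ≤ m) (F : ℕ → ℚ) :
    ∑ t : IncTree (m+1), F (numLeaves t) * 2 ^ (m + 1 - numLeaves t) =
    ∑ t : IncTree m, (2 * numLeaves t * F (numLeaves t)
      + (m + 1 - 2 * numLeaves t) * F (numLeaves t + 1)) * 2 ^ (m - numLeaves t) := by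
  rw [← (ext_bij hm).sum_comp, Fintype.sum_sigma]
  refine Finset.sum_congr rfl fun t _ => ?_
  simp only [ext_nl]
  set o := numLeaves t with ho
  have hle : o ≤ m := nl_le t
  have e := count_eq hm t
  have e' : (m + 1 - 2 * o : ℚ) = (Finset.univ.filter (fun j => numChildren t j = 1)).card := by
    have : ((2 * o + (Finset.univ.filter (fun j => numChildren t j = 1)).card : ℕ) : ℚ) = ((m + 1 : ℕ) : ℚ) := by rw [← e]
    push_cast at this
    linarith
  rw [e']
  let G : Fin m → ℚ := fun j => F (if numChildren t j = 0 then o else o + 1) *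
    2 ^ (m + 1 - if numChildren t j = 0 then o else o + 1)
  have h1 : ∑ x : {j : Fin m // numChildren t j ≤ 1}, G x.1
      = ∑ j ∈ Finset.univ.filter (fun j => numChildren t j ≤ 1), G j :=
    (Finset.sum_subtype _ (by simp) G).symm
  refine h1.trans ?_
  rw [Finset.sum_filter]
  have h2 : ∀ j, (if numChildren t j ≤ 1 then G j else 0) =
      (if numChildren t j = 0 then 2 * F o * 2 ^ (m - o) else 0) +
      (if numChildren t j = 1 then F (o+1) * 2 ^ (m - o) else 0) := by
    intro j
    simp only [G]
    have a : m + 1 - o = (m - o) + 1 := by omega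
    have b : m + 1 - (o + 1) = m - o := by omega
    rcases Nat.lt_or_ge (numChildren t j) 2 with h | h
    · interval_cases h' : numChildren t j
      · simp [a, pow_succ]; ring
      · simp [b]
    · have x1 : ¬ numChildren t j ≤ 1 := by omega
      have x2 : ¬ numChildren t j = 1 := by omega
      have x3 : ¬ numChildren t j = 0 := by omega
      simp only [x1, x2, x3, if_false, add_zero]
  rw [Finset.sum_congr rfl (fun j _ => h2 j), Finset.sum_add_distrib, ← Finset.sum_filter,
    ← Finset.sum_filter, Finset.sum_const, Finset.sum_const]
  have : (Finset.univ.filter (fun j => numChildren t j = 0)).card = o := rfl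
  rw [this]
  simp only [nsmul_eq_mul]
  ring

theorem base_sum (F : ℕ → ℚ) :
    ∑ t : IncTree 1, F (numLeaves t) * 2 ^ (1 - numLeaves t) = F 1 := by
  have h : ∀ t : IncTree 1, numLeaves t = 1 := by
    intro t
    have := count_eq le_rfl t
    have h2 := sum_nc le_rfl t
    simp at h2
    simp [numLeaves, Finset.filter_singleton, h2]
  have hc : Fintype.card (IncTree 1) = 1 := by
    rw [Fintype.card_eq_one_iff]
    refine ⟨⟨id, ?_, ?_, ?_⟩, ?_⟩
    · simp
    · intro i; omega
    · intro j; simp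
    · intro y; exact Subtype.ext (Subsingleton.elim _ _)
  simp [h, hc]

def SS (k m : ℕ) : ℚ := ∑ t : IncTree m, (numLeaves t : ℚ) ^ k * 2 ^ (m - numLeaves t)

theorem SS0 {m : ℕ} (hm : 1 ≤ m) : SS 0 (m+1) = (m+1) * SS 0 m := by
  unfold SS
  rw [rec_sum hm (fun o => (o:ℚ)^0), Finset.mul_sum]
  refine Finset.sum_congr rfl fun t _ => ?_
  push_cast; ring

theorem SS1 {m : ℕ} (hm : 1 ≤ m) : SS 1 (m+1) = (m-1) * SS 1 m + (m+1) * SS 0 m := by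
  unfold SS
  rw [rec_sum hm (fun o => (o:ℚ)^1), Finset.mul_sum, Finset.mul_sum, ← Finset.sum_add_distrib]
  refine Finset.sum_congr rfl fun t _ => ?_
  push_cast; ring

theorem SS2 {m : ℕ} (hm : 1 ≤ m) :
    SS 2 (m+1) = (m-3) * SS 2 m + 2 * m * SS 1 m + (m+1) * SS 0 m := by
  unfold SS
  rw [rec_sum hm (fun o => (o:ℚ)^2), Finset.mul_sum, Finset.mul_sum, Finset.mul_sum,
    ← Finset.sum_add_distrib, ← Finset.sum_add_distrib]
  refine Finset.sum_congr rfl fun t _ => ?_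
  push_cast; ring

theorem SS0_eq {m : ℕ} (hm : 1 ≤ m) : SS 0 m = m.factorial := by
  induction m, hm using Nat.le_induction with
  | base =>
    have h := base_sum (fun o => (o:ℚ)^0)
    unfold SS
    rw [h]; simp
  | succ m hm ih => rw [SS0 hm, ih, Nat.factorial_succ]; push_cast; ring

theorem SS1_eq {m : ℕ} (hm : 2 ≤ m) : SS 1 m = m.factorial * ((m+1)/3) := by
  induction m, hm using Nat.le_induction with
  | base => rw [SS1 le_rfl, SS0_eq le_rfl]; norm_num
  | succ m hm ih =>
    rw [SS1 (by omega), ih, SS0_eq (by omega), Nat.factorial_succ]; push_cast; ring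

theorem SS2_eq {m : ℕ} (hm : 4 ≤ m) :
    SS 2 m = m.factorial * (((m : ℚ) + 1) ^ 2 / 9 + 2 * ((m : ℚ) + 1) / 45) := by
  induction m, hm using Nat.le_induction with
  | base =>
    rw [SS2 (by omega), SS0_eq (by omega), SS1_eq (by omega)]
    norm_num [Nat.factorial]
  | succ m hm ih =>
    rw [SS2 (by omega), ih, SS1_eq (by omega), SS0_eq (by omega), Nat.factorial_succ]
    push_cast; ring

/-- `Σ_{t ∈ I_m} o(t)²·2^{m − o(t)} = m!·((m+1)²/9 + 2(m+1)/45)` for `m ≥ 6`: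
the variance of the number of cherries of a coalescent-generated ranked tree
of size `n = m + 1 > 6` is `2n/45`. -/
theorem second_moment_cherries (m : ℕ) (hm : 6 ≤ m) :
    ∑ t : IncTree m, (numLeaves t : ℚ) ^ 2 * 2 ^ (m - numLeaves t) =
      (Nat.factorial m : ℚ) *
        (((m : ℚ) + 1) ^ 2 / 9 + 2 * ((m : ℚ) + 1) / 45) := by
  exact SS2_eq (by omega)
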